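/- Let E be a non-trivial equational theory, Γ an E-unification problem, and S a set of E-unifiers of Γ such that VRan(σ) ∪ Dom(σ) ⊆ Var(Γ) holds for all σ ∈ S. Then S is a minimal complete set of E-unifiers of Γ w.r.t. the unrestricted instantiation preorder ≤_E^V if and only if S is a minimal complete set of E-unifiers of Γ w.r.t. the restricted instantiation preorder ≤_E^{Var(Γ)}. -/

import Mathlib

namespace UnifFW

/-- First-order terms over a signature `F` (an arity-indexed family of function
symbols), with variables from the countably infinite set `V = ℕ`. -/
inductive Term (F : ℕ → Type) : Type
  | var : ℕ → Term F
  | app : (n : ℕ) → F n → (Fin n → Term F) → Term F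

variable {F : ℕ → Type}

/-- The set of variables occurring in a term. -/
def Term.vars : Term F → Set ℕ
  | .var x => {x}
  | .app _ _ ts => ⋃ i, (ts i).vars

/-- Homomorphic extension of a map `V → T(Σ,V)` to terms. -/
def Term.subst (σ : ℕ → Term F) : Term F → Term F
  | .var x => σ x
  | .app n f ts => .app n f (fun i => (ts i).subst σ)

/-- The congruence `≈_E` induced by a set `E` of identities: the smallest
equivalence relation containing all substitution instances of identities of `E`
and compatible with the term constructors. -/
inductive EqE (E : Set (Term F × Term F)) : Term F → Term F → Prop
  | ax {s t : Term F} (σ : ℕ → Term F) : (s, t) ∈ E → EqE E (s.subst σ) (t.subst σ)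
  | refl (t : Term F) : EqE E t t
  | symm {s t : Term F} : EqE E s t → EqE E t s
  | trans {s t u : Term F} : EqE E s t → EqE E t u → EqE E s u
  | congr {n : ℕ} (f : F n) {ts us : Fin n → Term F} :
      (∀ i, EqE E (ts i) (us i)) → EqE E (.app n f ts) (.app n f us)

/-- A theory is non-trivial if distinct variables are not equated. -/
def NonTrivial (E : Set (Term F × Term F)) : Prop :=
  ∀ x y : ℕ, x ≠ y → ¬ EqE E (.var x) (.var y)

/-- A theory is regular if both sides of each identity have the same variables. -/
def Regular (E : Set (Term F × Term F)) : Prop :=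
  ∀ p ∈ E, (Prod.fst p).vars = (Prod.snd p).vars

/-- A substitution: a map `V → T(Σ,V)` with finite domain. -/
structure Subst (F : ℕ → Type) where
  toFun : ℕ → Term F
  finite_dom : {x : ℕ | toFun x ≠ Term.var x}.Finite

/-- The domain of a substitution. -/
def Subst.Dom (σ : Subst F) : Set ℕ := {x : ℕ | σ.toFun x ≠ Term.var x}

/-- The variable range of a substitution: all variables occurring in the images
of domain variables. -/
def Subst.VRan (σ : Subst F) : Set ℕ := ⋃ x ∈ σ.Dom, (σ.toFun x).vars

/-- The instantiation preorder `σ ≤_E^X θ`: some substitution `λ` satisfies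
`λ(σ(x)) ≈_E θ(x)` for all `x ∈ X`. -/
def InstLE (E : Set (Term F × Term F)) (X : Set ℕ) (σ θ : Subst F) : Prop :=
  ∃ lam : Subst F, ∀ x ∈ X, EqE E ((σ.toFun x).subst lam.toFun) (θ.toFun x)

/-- The equivalence `σ ∼_E^X θ` induced by the instantiation preorder. -/
def InstEquiv (E : Set (Term F × Term F)) (X : Set ℕ) (σ θ : Subst F) : Prop :=
  InstLE E X σ θ ∧ InstLE E X θ σ

/-- The strict instantiation order `σ <_E^X θ`. -/
def InstLT (E : Set (Term F × Term F)) (X : Set ℕ) (σ θ : Subst F) : Prop :=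
  InstLE E X σ θ ∧ ¬ InstLE E X θ σ

/-- The set of variables occurring in a unification problem. -/
def VarsP (Γ : Set (Term F × Term F)) : Set ℕ :=
  ⋃ p ∈ Γ, (Prod.fst p).vars ∪ (Prod.snd p).vars

/-- `σ` is an `E`-unifier of the unification problem `Γ`. -/
def Unifier (E Γ : Set (Term F × Term F)) (σ : Subst F) : Prop :=
  ∀ p ∈ Γ, EqE E ((Prod.fst p).subst σ.toFun) ((Prod.snd p).subst σ.toFun)

/-- A unification problem is solvable if it has a unifier. -/
def Solvable (E Γ : Set (Term F × Term F)) : Prop := ∃ σ : Subst F, Unifier E Γ σ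

/-- `S` is a complete set of `E`-unifiers of `Γ` w.r.t. `≤_E^X`. -/
def CompleteSet (E Γ : Set (Term F × Term F)) (X : Set ℕ) (S : Set (Subst F)) : Prop :=
  (∀ σ ∈ S, Unifier E Γ σ) ∧ ∀ θ : Subst F, Unifier E Γ θ → ∃ σ ∈ S, InstLE E X σ θ

/-- `S` is a minimal complete set of `E`-unifiers of `Γ` w.r.t. `≤_E^X`:
complete, and no two distinct elements are comparable. -/
def MinimalComplete (E Γ : Set (Term F × Term F)) (X : Set ℕ) (S : Set (Subst F)) : Prop :=
  CompleteSet E Γ X S ∧ ∀ σ ∈ S, ∀ θ ∈ S, σ ≠ θ → ¬ InstLE E X σ θ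

/-- `Γ` has unification type unitary w.r.t. `≤_E^X`. -/
def TypeUnitary (E Γ : Set (Term F × Term F)) (X : Set ℕ) : Prop :=
  ∃ σ : Subst F, MinimalComplete E Γ X {σ}

/-- `Γ` has unification type finitary w.r.t. `≤_E^X`. -/
def TypeFinitary (E Γ : Set (Term F × Term F)) (X : Set ℕ) : Prop :=
  ∃ S : Set (Subst F), MinimalComplete E Γ X S ∧ S.Finite ∧ 1 < S.ncard

/-- `Γ` has unification type infinitary w.r.t. `≤_E^X`. -/
def TypeInfinitary (E Γ : Set (Term F × Term F)) (X : Set ℕ) : Prop :=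
  ∃ S : Set (Subst F), MinimalComplete E Γ X S ∧ S.Infinite

/-- `Γ` has unification type zero w.r.t. `≤_E^X`. -/
def TypeZero (E Γ : Set (Term F × Term F)) (X : Set ℕ) : Prop :=
  ¬ ∃ S : Set (Subst F), MinimalComplete E Γ X S

/-- `σ` is a `≤_E^X`-minimal `E`-unifier of `Γ`. -/
def MinUnifier (E Γ : Set (Term F × Term F)) (X : Set ℕ) (σ : Subst F) : Prop :=
  Unifier E Γ σ ∧ ∀ θ : Subst F, Unifier E Γ θ → InstLE E X θ σ → InstLE E X σ θ

/-- The set `C_E(Γ)` of unifiers all of whose range variables occur in the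
images of at least two distinct variables. -/
def CSet (E Γ : Set (Term F × Term F)) : Set (Subst F) :=
  {σ : Subst F | Unifier E Γ σ ∧
    ∀ y ∈ σ.VRan, ∃ x x' : ℕ, x ≠ x' ∧ y ∈ (σ.toFun x).vars ∩ (σ.toFun x').vars}

/-- `E` is Noetherian w.r.t. the unrestricted instantiation preorder: there is
no infinite strictly descending chain `σ₁ >_E^V σ₂ >_E^V ⋯`. -/
def Noetherian (E : Set (Term F × Term F)) : Prop :=
  ¬ ∃ f : ℕ → Subst F, ∀ n : ℕ, InstLT E Set.univ (f (n + 1)) (f n)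


/-- The image of a term depends only on the substitution's values at its variables. -/
theorem Term.subst_congr {F : ℕ → Type} {σ τ : ℕ → Term F} {t : Term F}
    (h : ∀ x ∈ t.vars, σ x = τ x) : t.subst σ = t.subst τ := by
  induction t with
  | var x => exact h x rfl
  | app n f ts ih =>
    simp only [Term.subst, Term.app.injEq, heq_eq_eq, true_and]
    funext i
    exact ih i fun x hx => h x (Set.mem_iUnion.2 ⟨i, hx⟩)

theorem InstLE.mono {F : ℕ → Type} {E : Set (Term F × Term F)} {X Y : Set ℕ} {σ θ : Subst F}
    (hXY : X ⊆ Y) (h : InstLE E Y σ θ) : InstLE E X σ θ :=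
  h.imp fun _ hlam x hx => hlam x (hXY hx)

/-- Restricting the instantiation preorder to `X` changes nothing below a substitution that only
involves variables of `X`. -/
theorem instLE_univ_iff {F : ℕ → Type} {E : Set (Term F × Term F)} {X : Set ℕ} {σ θ : Subst F}
    (hσ : σ.VRan ∪ σ.Dom ⊆ X) : InstLE E Set.univ σ θ ↔ InstLE E X σ θ := by
  classical
  refine ⟨InstLE.mono (Set.subset_univ X), fun ⟨lam, hlam⟩ => ?_⟩
  let mu : Subst F :=
    { toFun := fun x => if x ∈ X then lam.toFun x else θ.toFun x
      finite_dom := (lam.finite_dom.union θ.finite_dom).subset fun x hx => by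
        by_cases hxX : x ∈ X
        · exact Or.inl (by simpa [hxX] using hx)
        · exact Or.inr (by simpa [hxX] using hx) }
  refine ⟨mu, fun x _ => ?_⟩
  by_cases hxX : x ∈ X
  · have hsub : (σ.toFun x).vars ⊆ X := by
      by_cases hx : σ.toFun x = Term.var x
      · rw [hx]
        exact Set.singleton_subset_iff.2 hxX
      · exact fun y hy => hσ (Or.inl (Set.mem_biUnion (show x ∈ σ.Dom from hx) hy))
    have heq : (σ.toFun x).subst mu.toFun = (σ.toFun x).subst lam.toFun :=
      Term.subst_congr fun y hy => if_pos (hsub hy)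
    rw [heq]
    exact hlam x hxX
  · have hx : σ.toFun x = Term.var x := by
      by_contra hx
      exact hxX (hσ (Or.inr hx))
    have heq : (σ.toFun x).subst mu.toFun = θ.toFun x := by
      rw [hx]
      exact if_neg hxX
    rw [heq]
    exact EqE.refl _

/-- Lemma `stays:same:lem`: if all elements of a set `S` of
`E`-unifiers of `Γ` satisfy `VRan(σ) ∪ Dom(σ) ⊆ Var(Γ)`, then `S` is a minimal
complete set of `E`-unifiers w.r.t. the unrestricted instantiation preorder
iff it is one w.r.t. the restricted instantiation preorder. -/
theorem stmt2 {F : ℕ → Type} (E : Set (Term F × Term F)) (hE : NonTrivial E)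
    (Γ : Set (Term F × Term F)) (hΓ : Γ.Finite) (S : Set (Subst F))
    (hS : ∀ σ ∈ S, Unifier E Γ σ)
    (hvars : ∀ σ ∈ S, σ.VRan ∪ σ.Dom ⊆ VarsP Γ) :
    MinimalComplete E Γ Set.univ S ↔ MinimalComplete E Γ (VarsP Γ) S := by
  have key : ∀ σ ∈ S, ∀ θ, InstLE E Set.univ σ θ ↔ InstLE E (VarsP Γ) σ θ :=
    fun σ hσ θ => instLE_univ_iff (hvars σ hσ)
  unfold MinimalComplete CompleteSet
  refine and_congr (and_congr_right' ?_) ?_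
  · exact forall₂_congr fun θ _ => exists_congr fun σ => and_congr_right fun hσ => key σ hσ θ
  · exact forall₂_congr fun σ hσ => forall₃_congr fun θ _ _ => not_congr (key σ hσ θ)
end UnifFW
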